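/- Let S, N, W ∈ ℝ² be affinely independent, K = conv{S, N, W} with area |K| and centroid G_K = (S + N + W)/3, and let B, C ∈ ℝ². Set P = (W + N + B)/3, Q = (S + W + C)/3, with radii of gyration ρ_K, ρ_P, ρ_Q of (S,N,W), (W,N,B), (S,W,C). Let n_SN be the unit vector orthogonal to N − S with ⟨n_SN, W − S⟩ < 0 (pointing away from K), n_NW the unit vector orthogonal to W − N with ⟨n_NW, S − N⟩ < 0, and n_WS the unit vector orthogonal to S − W with ⟨n_WS, N − W⟩ < 0. Let φ be a C¹ vector field on a neighborhood of K whose divergence is constant on K. Define, with arclength parametrizations: η = ∫₀^{‖SN‖} ⟨φ(S + s·(N−S)/‖SN‖), n_SN⟩ ds, η₁ its first moment (factor s) and η̃₂ its reversed second moment (factor (‖SN‖ − s)²); β = ∫₀^{‖NW‖} ⟨φ(N + s·(W−N)/‖NW‖), n_NW⟩ ds and β̃₂ its reversed second moment (factor (‖NW‖ − s)²); γ = ∫₀^{‖WS‖} ⟨φ(W + s·(S−W)/‖WS‖), n_WS⟩ ds and γ₂ its second moment (factor s²). Assume: γ₂ = (ρ_Q² + ‖Q − W‖²)·γ; β̃₂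 = (ρ_P² + ‖P − W‖²)·β; η̃₂ = (ρ_K² + ‖G_K − N‖²)·η − (1/6)·⟨B − S, (B−N)+(W−N)+(S−N)⟩·β − (1/6)·⟨C − N, (W−N)+(C−N)+(S−N)⟩·γ; and η₁ = (1/‖SN‖)·⟨(G_K − S)·η − (P − G_K)·β − (Q − G_K)·γ, N − S⟩. Then (1/(2|K|))·∫_K ⟨φ(x), W − x⟩ dx = (1/‖SN‖)·⟨(G_K − N)·η − (P − G_K)·β − (Q − G_K)·γ, n_SN⟩. (Lemma 4, second identity (3.25).) -/

import Mathlib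

open MeasureTheory
open scoped RealInnerProductSpace

/-- The clockwise quarter turn of the plane. -/
noncomputable def quarterTurn (v : EuclideanSpace ℝ (Fin 2)) : EuclideanSpace ℝ (Fin 2) :=
  !₂[v 1, -v 0]

lemma inner_eq_coord (x y : EuclideanSpace ℝ (Fin 2)) : ⟪x, y⟫ = x 0 * y 0 + x 1 * y 1 := by
  simp [PiLp.inner_apply, Fin.sum_univ_two, mul_comm]

lemma norm_sq_eq_coord (x : EuclideanSpace ℝ (Fin 2)) : ‖x‖ ^ 2 = x 0 ^ 2 + x 1 ^ 2 := by
  rw [EuclideanSpace.real_norm_sq_eq, Fin.sum_univ_two]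

lemma inner_quarterTurn (x v : EuclideanSpace ℝ (Fin 2)) :
    ⟪x, quarterTurn v⟫ = x 0 * v 1 - x 1 * v 0 := by
  rw [inner_eq_coord]
  simp [quarterTurn]
  ring

lemma exists_smul_unit_normal_eq_quarterTurn {n v : EuclideanSpace ℝ (Fin 2)}
    (hn : ‖n‖ = 1) (hnv : ⟪n, v⟫ = 0) : ∃ k : ℝ, k ^ 2 = ‖v‖ ^ 2 ∧ k • n = quarterTurn v := by
  have hv := norm_sq_eq_coord v
  have hn2 := norm_sq_eq_coord n
  rw [hn] at hn2
  rw [inner_eq_coord] at hnv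
  have hk0 : (n 0 * v 1 - n 1 * v 0) * n 0 = v 1 := by linear_combination (-v 1) * hn2 - n 1 * hnv
  have hk1 : (n 0 * v 1 - n 1 * v 0) * n 1 = -v 0 := by linear_combination v 0 * hn2 + n 0 * hnv
  refine ⟨n 0 * v 1 - n 1 * v 0, by linear_combination v 1 * hk0 - v 0 * hk1 - hv, ?_⟩
  ext i
  fin_cases i
  · simp [quarterTurn, hk0]
  · simp [quarterTurn, hk1]

lemma inner_quarterTurn_ne_zero {n v w : EuclideanSpace ℝ (Fin 2)} (hv : v ≠ 0)
    (hn : ‖n‖ = 1) (hnv : ⟪n, v⟫ = 0) (hnw : ⟪n, w⟫ < 0) : ⟪w, quarterTurn v⟫ ≠ 0 := by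
  obtain ⟨k, hk2, hk⟩ := exists_smul_unit_normal_eq_quarterTurn hn hnv
  have hk0 : k ≠ 0 := by
    rintro rfl
    exact hv (by simpa using hk2.symm)
  rw [← hk, real_inner_smul_right, real_inner_comm]
  exact mul_ne_zero hk0 hnw.ne

lemma norm_smul_unit_normal {n v w : EuclideanSpace ℝ (Fin 2)} {ε : ℝ} (hε : ε ^ 2 = 1)
    (hn : ‖n‖ = 1) (hnv : ⟪n, v⟫ = 0) (hnw : ⟪n, w⟫ < 0) (h : ε * ⟪w, quarterTurn v⟫ < 0) :
    ‖v‖ • n = ε • quarterTurn v := by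
  obtain ⟨k, hk2, hk⟩ := exists_smul_unit_normal_eq_quarterTurn hn hnv
  rw [← hk, real_inner_smul_right, real_inner_comm, ← mul_assoc] at h
  have hεk : 0 ≤ ε * k := (pos_of_mul_neg_left h hnw.le).le
  have hnorm : ‖v‖ = ε * k := by
    refine (pow_left_inj₀ (norm_nonneg v) hεk two_ne_zero).1 ?_
    rw [mul_pow, hε, one_mul, hk2]
  rw [hnorm, mul_smul, hk]

/-- The reference triangle with vertices `(0, 0)`, `(1, 0)`, `(0, 1)`. -/
def refTriangle : Set (ℝ × ℝ) := {p | 0 ≤ p.1 ∧ 0 ≤ p.2 ∧ p.1 + p.2 ≤ 1}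

lemma isClosed_refTriangle : IsClosed refTriangle :=
  (isClosed_le continuous_const continuous_fst).inter
    ((isClosed_le continuous_const continuous_snd).inter
      (isClosed_le (continuous_fst.add continuous_snd) continuous_const))

lemma isCompact_refTriangle : IsCompact refTriangle := by
  refine (isCompact_Icc (a := ((0, 0) : ℝ × ℝ)) (b := (1, 1))).of_isClosed_subset
    isClosed_refTriangle ?_
  rintro ⟨x, y⟩ ⟨hx, hy, hxy⟩
  simp only at hx hy hxy
  exact ⟨⟨hx, hy⟩, ⟨by simp only; linarith, by simp only; linarith⟩⟩

lemma convex_refTriangle : Convex ℝ refTriangle := by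
  rintro ⟨x, y⟩ ⟨hx, hy, hxy⟩ ⟨x', y'⟩ ⟨hx', hy', hxy'⟩ a b ha hb hab
  simp only at hx hy hxy hx' hy' hxy'
  refine ⟨?_, ?_, ?_⟩
  · simp only [Prod.smul_mk, Prod.mk_add_mk, smul_eq_mul]; positivity
  · simp only [Prod.smul_mk, Prod.mk_add_mk, smul_eq_mul]; positivity
  · simp only [Prod.smul_mk, Prod.mk_add_mk, smul_eq_mul]
    nlinarith [mul_le_mul_of_nonneg_left hxy ha, mul_le_mul_of_nonneg_left hxy' hb]

lemma setIntegral_refTriangle {g : ℝ × ℝ → ℝ} (hg : ContinuousOn g refTriangle) :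
    ∫ p in refTriangle, g p = ∫ x in (0 : ℝ)..1, ∫ y in (0 : ℝ)..(1 - x), g (x, y) := by
  have hT := isClosed_refTriangle.measurableSet
  have hint : Integrable (refTriangle.indicator g) :=
    (integrable_indicator_iff hT).2 (hg.integrableOn_compact isCompact_refTriangle)
  rw [← integral_indicator hT, Measure.volume_eq_prod, integral_prod _ hint,
    intervalIntegral.integral_of_le zero_le_one, ← integral_Icc_eq_integral_Ioc,
    ← integral_indicator measurableSet_Icc]
  congr 1
  ext x
  by_cases hx : x ∈ Set.Icc (0 : ℝ) 1
  · rw [Set.indicator_of_mem hx, intervalIntegral.integral_of_le (by linarith [hx.2]),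
      ← integral_Icc_eq_integral_Ioc, ← integral_indicator measurableSet_Icc]
    congr 1
    ext y
    refine Set.indicator_eq_indicator ?_ rfl
    simp only [refTriangle, Set.mem_ofPred_eq, Set.mem_Icc, hx.1, true_and]
    exact and_congr_right fun _ => ⟨fun h => by linarith, fun h => by linarith⟩
  · rw [Set.indicator_of_notMem hx]
    refine (integral_congr_ae (.of_forall fun y => ?_)).trans (integral_zero ℝ ℝ)
    refine Set.indicator_of_notMem ?_ _
    rintro ⟨h0, h1, h2⟩
    simp only at h0 h1 h2
    exact hx ⟨h0, by linarith⟩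

lemma setIntegral_refTriangle_swap (g : ℝ × ℝ → ℝ) :
    ∫ p in refTriangle, g p.swap = ∫ p in refTriangle, g p := by
  have h := (Measure.measurePreserving_swap (μ := (volume : Measure ℝ))
    (ν := (volume : Measure ℝ))).setIntegral_preimage_emb
      MeasurableEquiv.prodComm.measurableEmbedding g refTriangle
  have hT : Prod.swap ⁻¹' refTriangle = refTriangle := by
    ext ⟨x, y⟩
    simp only [refTriangle, Set.mem_preimage, Prod.swap_prod_mk, Set.mem_ofPred_eq, add_comm y x]
    tauto
  rw [hT] at h
  exact h

lemma setIntegral_refTriangle_deriv_snd {f f' : ℝ × ℝ → ℝ} (hf' : ContinuousOn f' refTriangle)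
    (hf : ∀ p ∈ refTriangle, HasDerivAt (fun y => f (p.1, y)) (f' p) p.2) :
    ∫ p in refTriangle, f' p = ∫ x in (0 : ℝ)..1, (f (x, 1 - x) - f (x, 0)) := by
  rw [setIntegral_refTriangle hf']
  refine intervalIntegral.integral_congr fun x hx => ?_
  rw [Set.uIcc_of_le zero_le_one] at hx
  have hle : 0 ≤ 1 - x := by linarith [hx.2]
  have hmem : ∀ y ∈ Set.uIcc 0 (1 - x), (x, y) ∈ refTriangle := by
    intro y hy
    rw [Set.uIcc_of_le hle] at hy
    exact ⟨hx.1, hy.1, by simp only; linarith [hy.2]⟩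
  have hc : ContinuousOn (fun y => f' (x, y)) (Set.uIcc 0 (1 - x)) := hf'.comp (by fun_prop) hmem
  exact intervalIntegral.integral_eq_sub_of_hasDerivAt (f := fun y => f (x, y))
    (fun y hy => hf (x, y) (hmem y hy)) hc.intervalIntegrable

lemma setIntegral_refTriangle_deriv_fst {f f' : ℝ × ℝ → ℝ} (hf' : ContinuousOn f' refTriangle)
    (hf : ∀ p ∈ refTriangle, HasDerivAt (fun x => f (x, p.2)) (f' p) p.1) :
    ∫ p in refTriangle, f' p = ∫ y in (0 : ℝ)..1, (f (1 - y, y) - f (0, y)) := by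
  have hswap : ∀ p ∈ refTriangle, p.swap ∈ refTriangle := fun p hp =>
    ⟨hp.2.1, hp.1, by simpa [add_comm] using hp.2.2⟩
  rw [← setIntegral_refTriangle_swap]
  exact setIntegral_refTriangle_deriv_snd (f := fun p => f p.swap)
    (hf'.comp continuous_swap.continuousOn hswap) fun p hp => hf p.swap (hswap p hp)

/-- The affine parametrization of the triangle `S N W` by the reference triangle. -/
noncomputable def triangleMap (S N W : EuclideanSpace ℝ (Fin 2)) (p : ℝ × ℝ) :
    EuclideanSpace ℝ (Fin 2) :=
  W + (p.1 • (S - W) + p.2 • (N - W))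

lemma continuous_triangleMap (S N W : EuclideanSpace ℝ (Fin 2)) :
    Continuous (triangleMap S N W) := by
  unfold triangleMap
  fun_prop

lemma triangleMap_image (S N W : EuclideanSpace ℝ (Fin 2)) :
    triangleMap S N W '' refTriangle = convexHull ℝ {S, N, W} := by
  apply Set.Subset.antisymm
  · rintro _ ⟨⟨a, b⟩, ⟨ha, hb, hab⟩, rfl⟩
    simp only at ha hb hab
    have hK := convex_convexHull ℝ ({S, N, W} : Set (EuclideanSpace ℝ (Fin 2)))
    have hsum := hK.sum_mem (t := Finset.univ) (w := ![a, b, 1 - a - b]) (z := ![S, N, W])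
      (by
        intro i _
        fin_cases i
        · exact ha
        · exact hb
        · change 0 ≤ 1 - a - b
          linarith)
      (by simp [Fin.sum_univ_three])
      (by
        intro i _
        apply subset_convexHull
        fin_cases i <;> simp)
    convert hsum using 1
    simp only [triangleMap, Fin.sum_univ_three, Matrix.cons_val_zero, Matrix.cons_val_one,
      Matrix.cons_val]
    module
  · have hconv : Convex ℝ (triangleMap S N W '' refTriangle) := by
      rintro _ ⟨p, hp, rfl⟩ _ ⟨q, hq, rfl⟩ a b ha hb hab
      refine ⟨a • p + b • q, convex_refTriangle hp hq ha hb hab, ?_⟩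
      obtain rfl : b = 1 - a := by linarith
      simp only [triangleMap, Prod.fst_add, Prod.snd_add, Prod.smul_fst, Prod.smul_snd,
        smul_eq_mul]
      module
    refine convexHull_min ?_ hconv
    rintro x (rfl | rfl | rfl)
    · exact ⟨(1, 0), by simp [refTriangle], by simp [triangleMap]⟩
    · exact ⟨(0, 1), by simp [refTriangle], by simp [triangleMap]⟩
    · exact ⟨(0, 0), by simp [refTriangle], by simp [triangleMap]⟩

lemma exists_setIntegral_triangle_eq {S N W : EuclideanSpace ℝ (Fin 2)}
    (h : ⟪S - W, quarterTurn (N - W)⟫ ≠ 0) :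
    ∃ D : ℝ, 0 < D ∧ ∀ g : EuclideanSpace ℝ (Fin 2) → ℝ,
      ∫ x in convexHull ℝ {S, N, W}, g x = D * ∫ p in refTriangle, g (triangleMap S N W p) := by
  rw [inner_quarterTurn] at h
  let f : ℝ × ℝ →ₗ[ℝ] EuclideanSpace ℝ (Fin 2) :=
    (LinearMap.fst ℝ ℝ ℝ).smulRight (S - W) + (LinearMap.snd ℝ ℝ ℝ).smulRight (N - W)
  have hf : Function.Injective f := by
    rw [injective_iff_map_eq_zero]
    rintro ⟨a, b⟩ hab
    have h0 := congrArg (fun x : EuclideanSpace ℝ (Fin 2) => x 0) hab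
    have h1 := congrArg (fun x : EuclideanSpace ℝ (Fin 2) => x 1) hab
    simp only [f, LinearMap.add_apply, LinearMap.smulRight_apply, LinearMap.fst_apply,
      LinearMap.snd_apply, PiLp.add_apply, PiLp.smul_apply, smul_eq_mul, PiLp.zero_apply]
      at h0 h1
    have ha : a = 0 := by
      apply (mul_eq_zero.1 _).resolve_right h
      linear_combination (N - W) 1 * h0 - (N - W) 0 * h1
    have hb : b = 0 := by
      apply (mul_eq_zero.1 _).resolve_right h
      linear_combination (S - W) 0 * h1 - (S - W) 1 * h0
    simp [ha, hb]
  let L : (ℝ × ℝ) ≃L[ℝ] EuclideanSpace ℝ (Fin 2) :=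
    (LinearEquiv.ofInjectiveOfFinrankEq f hf (by simp)).toContinuousLinearEquiv
  let F : (ℝ × ℝ) ≃ₜ EuclideanSpace ℝ (Fin 2) := L.toHomeomorph.trans (Homeomorph.addLeft W)
  let μ : Measure (EuclideanSpace ℝ (Fin 2)) := Measure.map L volume
  have hμ : μ.IsAddHaarMeasure := L.isAddHaarMeasure_map volume
  have hFμ : Measure.map F volume = μ := by
    have : (F : ℝ × ℝ → EuclideanSpace ℝ (Fin 2)) = (fun x => W + x) ∘ L := rfl
    rw [this, ← Measure.map_map (by fun_prop) L.continuous.measurable]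
    exact map_add_left_eq_self μ W
  refine ⟨Measure.addHaarScalarFactor volume μ,
    Measure.addHaarScalarFactor_pos_of_isAddHaarMeasure _ _, fun g => ?_⟩
  have hpre : F ⁻¹' convexHull ℝ {S, N, W} = refTriangle := by
    rw [← triangleMap_image]
    exact Set.preimage_image_eq _ F.injective
  have hmap : ∫ x in convexHull ℝ {S, N, W}, g x ∂μ =
      ∫ p in refTriangle, g (triangleMap S N W p) := by
    rw [← hFμ, F.measurableEmbedding.setIntegral_map, hpre]
    rfl
  conv_lhs => rw [Measure.isAddLeftInvariant_eq_smul volume μ]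
  rw [Measure.restrict_smul, integral_smul_nnreal_measure, hmap]
  rfl

lemma trace_mul_inner_quarterTurn
    (A : EuclideanSpace ℝ (Fin 2) →ₗ[ℝ] EuclideanSpace ℝ (Fin 2))
    (u v : EuclideanSpace ℝ (Fin 2)) :
    LinearMap.trace ℝ _ A * ⟪u, quarterTurn v⟫ =
      ⟪A u, quarterTurn v⟫ - ⟪A v, quarterTurn u⟫ := by
  have hA : ∀ w : EuclideanSpace ℝ (Fin 2),
      A w = w 0 • A (EuclideanSpace.single 0 1) + w 1 • A (EuclideanSpace.single 1 1) := by
    intro w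
    rw [← map_smul, ← map_smul, ← map_add]
    congr 1
    ext i
    fin_cases i <;> simp
  rw [LinearMap.trace_eq_sum_inner A (EuclideanSpace.basisFun (Fin 2) ℝ), Fin.sum_univ_two, hA u,
    hA v]
  simp only [inner_quarterTurn]
  simp [inner_eq_coord]
  ring

/-- The divergence theorem on the triangle `S N W`, pulled back to the reference triangle. -/
lemma integral_trace_triangleMap {S N W : EuclideanSpace ℝ (Fin 2)}
    {Φ : EuclideanSpace ℝ (Fin 2) → EuclideanSpace ℝ (Fin 2)}
    {Φ' : EuclideanSpace ℝ (Fin 2) → EuclideanSpace ℝ (Fin 2) →L[ℝ] EuclideanSpace ℝ (Fin 2)}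
    (hΦ : ∀ x ∈ convexHull ℝ {S, N, W}, HasFDerivAt Φ (Φ' x) x)
    (hΦ' : ContinuousOn Φ' (convexHull ℝ {S, N, W})) :
    ⟪S - W, quarterTurn (N - W)⟫ *
        ∫ p in refTriangle, LinearMap.trace ℝ _ (Φ' (triangleMap S N W p)).toLinearMap =
      (∫ t in (0 : ℝ)..1, ⟪Φ (S + t • (N - S)), quarterTurn (N - S)⟫) +
      (∫ t in (0 : ℝ)..1, ⟪Φ (N + t • (W - N)), quarterTurn (W - N)⟫) +
      ∫ t in (0 : ℝ)..1, ⟪Φ (W + t • (S - W)), quarterTurn (S - W)⟫ := by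
  have hmem : ∀ p ∈ refTriangle, triangleMap S N W p ∈ convexHull ℝ {S, N, W} := fun p hp =>
    triangleMap_image S N W ▸ Set.mem_image_of_mem _ hp
  have hcont' : ContinuousOn (fun p => Φ' (triangleMap S N W p)) refTriangle :=
    hΦ'.comp (continuous_triangleMap S N W).continuousOn hmem
  have hc : ∀ u v : EuclideanSpace ℝ (Fin 2),
      ContinuousOn (fun p => ⟪Φ' (triangleMap S N W p) u, v⟫) refTriangle := fun u v =>
    (hcont'.clm_apply continuousOn_const).inner continuousOn_const
  have hi : ∀ u v : EuclideanSpace ℝ (Fin 2),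
      IntegrableOn (fun p => ⟪Φ' (triangleMap S N W p) u, v⟫) refTriangle := fun u v =>
    (hc u v).integrableOn_compact isCompact_refTriangle
  have hfst := setIntegral_refTriangle_deriv_fst (hc (S - W) (quarterTurn (N - W)))
    (f := fun p => ⟪Φ (triangleMap S N W p), quarterTurn (N - W)⟫) (by
      intro p hp
      have h1 : HasDerivAt (fun x => triangleMap S N W (x, p.2)) (S - W) p.1 := by
        simpa [triangleMap] using
          (((hasDerivAt_id p.1).smul_const (S - W)).add_const (p.2 • (N - W))).const_add W
      simpa using ((hΦ _ (hmem p hp)).comp_hasDerivAt p.1 h1).inner ℝ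
        (hasDerivAt_const p.1 (quarterTurn (N - W))))
  have hsnd := setIntegral_refTriangle_deriv_snd (hc (N - W) (quarterTurn (S - W)))
    (f := fun p => ⟪Φ (triangleMap S N W p), quarterTurn (S - W)⟫) (by
      intro p hp
      have h1 : HasDerivAt (fun y => triangleMap S N W (p.1, y)) (N - W) p.2 := by
        simpa [triangleMap] using
          (((hasDerivAt_id p.2).smul_const (N - W)).const_add (p.1 • (S - W))).const_add W
      simpa using ((hΦ _ (hmem p hp)).comp_hasDerivAt p.2 h1).inner ℝ
        (hasDerivAt_const p.2 (quarterTurn (S - W))))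
  have hint : ∀ (γ : ℝ → ℝ × ℝ) (v : EuclideanSpace ℝ (Fin 2)), Continuous γ →
      (∀ t ∈ Set.Icc (0 : ℝ) 1, γ t ∈ refTriangle) →
      IntervalIntegrable (fun t => ⟪Φ (triangleMap S N W (γ t)), v⟫) volume 0 1 := by
    intro γ v hγ hγT
    refine ContinuousOn.intervalIntegrable ?_
    rw [Set.uIcc_of_le zero_le_one]
    have hΦc : ContinuousOn Φ (convexHull ℝ {S, N, W}) := fun x hx =>
      (hΦ x hx).continuousAt.continuousWithinAt
    exact (hΦc.comp ((continuous_triangleMap S N W).comp hγ).continuousOn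
      fun t ht => hmem _ (hγT t ht)).inner continuousOn_const
  have hanti : ∀ v, IntervalIntegrable (fun t : ℝ => ⟪Φ (triangleMap S N W (1 - t, t)), v⟫)
      volume 0 1 := fun v => hint _ v (by fun_prop) fun t ht =>
    ⟨by simp only; linarith [ht.2], ht.1, by simp⟩
  rw [← integral_const_mul]
  have hpt : ∀ p, ⟪S - W, quarterTurn (N - W)⟫ *
      LinearMap.trace ℝ _ (Φ' (triangleMap S N W p)).toLinearMap =
      ⟪Φ' (triangleMap S N W p) (S - W), quarterTurn (N - W)⟫ -
      ⟪Φ' (triangleMap S N W p) (N - W), quarterTurn (S - W)⟫ := fun p => by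
    rw [mul_comm]
    exact trace_mul_inner_quarterTurn _ _ _
  simp_rw [hpt]
  rw [integral_sub (hi _ _) (hi _ _), hfst, hsnd]
  rw [intervalIntegral.integral_sub (hanti _) (hint _ _ (by fun_prop) fun t ht =>
      ⟨le_rfl, ht.1, by simpa using ht.2⟩),
    intervalIntegral.integral_sub (hint _ _ (by fun_prop) fun t ht =>
      ⟨ht.1, by simp only; linarith [ht.2], by simp⟩) (hint _ _ (by fun_prop) fun t ht =>
      ⟨ht.1, le_rfl, by simpa using ht.2⟩)]
  have hrev : ∫ t in (0 : ℝ)..1, ⟪Φ (triangleMap S N W (t, 1 - t)), quarterTurn (S - W)⟫ =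
      ∫ t in (0 : ℝ)..1, ⟪Φ (triangleMap S N W (1 - t, t)), quarterTurn (S - W)⟫ := by
    simpa using intervalIntegral.integral_comp_sub_left (a := 0) (b := 1)
      (fun t : ℝ => ⟪Φ (triangleMap S N W (1 - t, t)), quarterTurn (S - W)⟫) 1
  have hNW : ∫ t in (0 : ℝ)..1, ⟪Φ (N + t • (W - N)), quarterTurn (W - N)⟫ =
      -∫ t in (0 : ℝ)..1, ⟪Φ (triangleMap S N W (0, t)), quarterTurn (N - W)⟫ := by
    have h := intervalIntegral.integral_comp_sub_left (a := 0) (b := 1)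
      (fun t : ℝ => ⟪Φ (triangleMap S N W (0, t)), quarterTurn (N - W)⟫) 1
    simp only [sub_self, sub_zero] at h
    rw [← h, ← intervalIntegral.integral_neg]
    refine intervalIntegral.integral_congr fun t _ => ?_
    have hx : triangleMap S N W (0, 1 - t) = N + t • (W - N) := by
      simp only [triangleMap]
      module
    simp only [hx, inner_quarterTurn, PiLp.sub_apply]
    ring
  have hSN : ∫ t in (0 : ℝ)..1, ⟪Φ (S + t • (N - S)), quarterTurn (N - S)⟫ =
      (∫ t in (0 : ℝ)..1, ⟪Φ (triangleMap S N W (1 - t, t)), quarterTurn (N - W)⟫) -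
      ∫ t in (0 : ℝ)..1, ⟪Φ (triangleMap S N W (1 - t, t)), quarterTurn (S - W)⟫ := by
    rw [← intervalIntegral.integral_sub (hanti _) (hanti _)]
    refine intervalIntegral.integral_congr fun t _ => ?_
    have hx : triangleMap S N W (1 - t, t) = S + t • (N - S) := by
      simp only [triangleMap]
      module
    simp only [hx, inner_quarterTurn, PiLp.sub_apply]
    ring
  have hWS : ∫ t in (0 : ℝ)..1, ⟪Φ (W + t • (S - W)), quarterTurn (S - W)⟫ =
      ∫ t in (0 : ℝ)..1, ⟪Φ (triangleMap S N W (t, 0)), quarterTurn (S - W)⟫ := by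
    simp [triangleMap]
  rw [hrev, hNW, hSN, hWS]
  ring

/-- Rescaling a weighted flux from arclength to the unit interval. -/
lemma integral_arclength_eq {n v : EuclideanSpace ℝ (Fin 2)} {ε : ℝ} (hv : v ≠ 0)
    (hn : ‖v‖ • n = ε • quarterTurn v) (w : ℝ → ℝ)
    (φ : EuclideanSpace ℝ (Fin 2) → EuclideanSpace ℝ (Fin 2)) (X : EuclideanSpace ℝ (Fin 2)) :
    ∫ s in (0 : ℝ)..‖v‖, w s * ⟪φ (X + s • (‖v‖⁻¹ • v)), n⟫ =
      ε * ∫ t in (0 : ℝ)..1, w (‖v‖ * t) * ⟪φ (X + t • v), quarterTurn v⟫ := by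
  have hv' : ‖v‖ ≠ 0 := norm_ne_zero_iff.2 hv
  have h := intervalIntegral.smul_integral_comp_mul_left (a := 0) (b := 1)
    (fun s => w s * ⟪φ (X + s • (‖v‖⁻¹ • v)), n⟫) ‖v‖
  simp only [mul_zero, mul_one] at h
  rw [← h, smul_eq_mul, ← intervalIntegral.integral_const_mul,
    ← intervalIntegral.integral_const_mul]
  refine intervalIntegral.integral_congr fun t _ => ?_
  have hx : (‖v‖ * t) • (‖v‖⁻¹ • v) = t • v := by
    rw [smul_smul]
    congr 1
    field_simp
  have hin : ‖v‖ * ⟪φ (X + t • v), n⟫ = ε * ⟪φ (X + t • v), quarterTurn v⟫ := by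
    rw [← real_inner_smul_right, hn, real_inner_smul_right]
  simp only [hx]
  linear_combination w (‖v‖ * t) * hin

lemma setIntegral_norm_sq_triangleMap (S N W : EuclideanSpace ℝ (Fin 2)) :
    ∫ p in refTriangle, ‖triangleMap S N W p - W‖ ^ 2 =
      (‖S - W‖ ^ 2 + ⟪S - W, N - W⟫ + ‖N - W‖ ^ 2) / 12 := by
  have hexp : ∀ p, ‖triangleMap S N W p - W‖ ^ 2 =
      p.1 ^ 2 * ‖S - W‖ ^ 2 + p.1 * p.2 * (2 * ⟪S - W, N - W⟫) + p.2 ^ 2 * ‖N - W‖ ^ 2 := by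
    intro p
    simp only [triangleMap, norm_sq_eq_coord, inner_eq_coord, PiLp.add_apply, PiLp.sub_apply,
      PiLp.smul_apply, smul_eq_mul]
    ring
  simp_rw [hexp]
  rw [setIntegral_refTriangle (by fun_prop)]
  generalize ‖S - W‖ ^ 2 = A
  generalize ⟪S - W, N - W⟫ = B
  generalize ‖N - W‖ ^ 2 = C
  have hin : ∀ x : ℝ, ∫ y in (0 : ℝ)..(1 - x), (x ^ 2 * A + x * y * (2 * B) + y ^ 2 * C) =
      (C / 3) + (B - C) * x + (A - 2 * B + C) * x ^ 2 + (B - A - C / 3) * x ^ 3 := by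
    intro x
    have hd : ∀ y ∈ Set.uIcc 0 (1 - x),
        HasDerivAt (fun y => x ^ 2 * A * y + x * B * y ^ 2 + C / 3 * y ^ 3)
          (x ^ 2 * A + x * y * (2 * B) + y ^ 2 * C) y := by
      intro y _
      refine ((((hasDerivAt_id y).const_mul (x ^ 2 * A)).add
        ((hasDerivAt_pow 2 y).const_mul (x * B))).add
        ((hasDerivAt_pow 3 y).const_mul (C / 3))).congr_deriv ?_
      norm_num
      ring
    rw [intervalIntegral.integral_eq_sub_of_hasDerivAt hd
      (Continuous.intervalIntegrable (by fun_prop) _ _)]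
    ring
  simp_rw [hin]
  have hd : ∀ x ∈ Set.uIcc (0 : ℝ) 1,
      HasDerivAt (fun x => C / 3 * x + (B - C) / 2 * x ^ 2 + (A - 2 * B + C) / 3 * x ^ 3 +
        (B - A - C / 3) / 4 * x ^ 4)
      (C / 3 + (B - C) * x + (A - 2 * B + C) * x ^ 2 + (B - A - C / 3) * x ^ 3) x := by
    intro x _
    refine (((((hasDerivAt_id x).const_mul (C / 3)).add
      ((hasDerivAt_pow 2 x).const_mul ((B - C) / 2))).add
      ((hasDerivAt_pow 3 x).const_mul ((A - 2 * B + C) / 3))).add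
      ((hasDerivAt_pow 4 x).const_mul ((B - A - C / 3) / 4))).congr_deriv ?_
    norm_num
    ring
  rw [intervalIntegral.integral_eq_sub_of_hasDerivAt hd
    (Continuous.intervalIntegrable (by fun_prop) _ _)]
  ring

lemma setIntegral_refTriangle_one : ∫ _p in refTriangle, (1 : ℝ) = 1 / 2 := by
  rw [setIntegral_refTriangle continuousOn_const]
  simp only [integral_one, sub_zero]
  rw [intervalIntegral.integral_sub (by simp) (by simp)]
  norm_num

lemma hasFDerivAt_norm_sq_smul {φ : EuclideanSpace ℝ (Fin 2) → EuclideanSpace ℝ (Fin 2)}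
    {φ' : EuclideanSpace ℝ (Fin 2) →L[ℝ] EuclideanSpace ℝ (Fin 2)}
    {x : EuclideanSpace ℝ (Fin 2)} (W : EuclideanSpace ℝ (Fin 2)) (h : HasFDerivAt φ φ' x) :
    HasFDerivAt (fun y => ‖y - W‖ ^ 2 • φ y)
      (‖x - W‖ ^ 2 • φ' + ((2 : ℝ) • innerSL ℝ (x - W)).smulRight (φ x)) x := by
  have hq : HasFDerivAt (fun y => ‖y - W‖ ^ 2) ((2 : ℝ) • innerSL ℝ (x - W)) x := by
    refine ((hasFDerivAt_id x).sub_const W).norm_sq.congr_fderiv ?_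
    ext y
    simp
  exact hq.smul h

lemma trace_norm_sq_smul_add (φ' : EuclideanSpace ℝ (Fin 2) →L[ℝ] EuclideanSpace ℝ (Fin 2))
    (q : ℝ) (u v : EuclideanSpace ℝ (Fin 2)) :
    LinearMap.trace ℝ _ (q • φ' + ((2 : ℝ) • innerSL ℝ u).smulRight v).toLinearMap =
      q * LinearMap.trace ℝ _ φ'.toLinearMap + 2 * ⟪u, v⟫ := by
  have h : (q • φ' + ((2 : ℝ) • innerSL ℝ u).smulRight v).toLinearMap =
      q • φ'.toLinearMap + (((2 : ℝ) • innerSL ℝ u).toLinearMap).smulRight v := rfl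
  rw [h, map_add, map_smul, LinearMap.trace_smulRight]
  rfl

lemma exists_sign_mul_neg {a : ℝ} (ha : a ≠ 0) : ∃ ε : ℝ, ε ^ 2 = 1 ∧ ε * a < 0 := by
  rcases lt_or_gt_of_ne ha with h | h
  · exact ⟨1, by norm_num, by linarith⟩
  · exact ⟨-1, by norm_num, by linarith⟩

/-- Lemma 4, second identity (3.25):
`(1/(2|K|)) ∫_K ⟨φ(x), W − x⟩ dx
   = (1/‖SN‖) ⟨η (G_K − N) − β (P − G_K) − γ (Q − G_K), n_SN⟩`. -/
theorem stmt12 (S N W : EuclideanSpace ℝ (Fin 2))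
    (hindep : AffineIndependent ℝ ![S, N, W])
    (B C : EuclideanSpace ℝ (Fin 2))
    (G_K P Q : EuclideanSpace ℝ (Fin 2))
    (hGK : G_K = (1 / 3 : ℝ) • (S + N + W))
    (hP : P = (1 / 3 : ℝ) • (W + N + B))
    (hQ : Q = (1 / 3 : ℝ) • (S + W + C))
    (ρK ρP ρQ : ℝ)
    (hρK : ρK = Real.sqrt ((1 / 36) * (‖S - N‖ ^ 2 + ‖N - W‖ ^ 2 + ‖W - S‖ ^ 2)))
    (hρP : ρP = Real.sqrt ((1 / 36) * (‖W - N‖ ^ 2 + ‖N - B‖ ^ 2 + ‖B - W‖ ^ 2)))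
    (hρQ : ρQ = Real.sqrt ((1 / 36) * (‖S - W‖ ^ 2 + ‖W - C‖ ^ 2 + ‖C - S‖ ^ 2)))
    (nSN nNW nWS : EuclideanSpace ℝ (Fin 2))
    (hnSN : ‖nSN‖ = 1) (hnSN0 : ⟪nSN, N - S⟫ = 0) (hnSNW : ⟪nSN, W - S⟫ < 0)
    (hnNW : ‖nNW‖ = 1) (hnNW0 : ⟪nNW, W - N⟫ = 0) (hnNWS : ⟪nNW, S - N⟫ < 0)
    (hnWS : ‖nWS‖ = 1) (hnWS0 : ⟪nWS, S - W⟫ = 0) (hnWSN : ⟪nWS, N - W⟫ < 0)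
    (φ : EuclideanSpace ℝ (Fin 2) → EuclideanSpace ℝ (Fin 2))
    (U : Set (EuclideanSpace ℝ (Fin 2))) (hU : IsOpen U)
    (hKU : convexHull ℝ {S, N, W} ⊆ U)
    (hφ : ContDiffOn ℝ 1 φ U)
    (c : ℝ)
    (hdiv : ∀ x ∈ convexHull ℝ ({S, N, W} : Set (EuclideanSpace ℝ (Fin 2))),
      LinearMap.trace ℝ (EuclideanSpace ℝ (Fin 2)) (fderiv ℝ φ x).toLinearMap = c)
    (η η₁ η₂' β β₂' γ γ₂ : ℝ)
    (hη : η = ∫ s in (0 : ℝ)..‖N - S‖, ⟪φ (S + s • ((‖N - S‖)⁻¹ • (N - S))), nSN⟫)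
    (hη₁ : η₁ = ∫ s in (0 : ℝ)..‖N - S‖,
      s * ⟪φ (S + s • ((‖N - S‖)⁻¹ • (N - S))), nSN⟫)
    (hη₂' : η₂' = ∫ s in (0 : ℝ)..‖N - S‖,
      (‖N - S‖ - s) ^ 2 * ⟪φ (S + s • ((‖N - S‖)⁻¹ • (N - S))), nSN⟫)
    (hβ : β = ∫ s in (0 : ℝ)..‖W - N‖, ⟪φ (N + s • ((‖W - N‖)⁻¹ • (W - N))), nNW⟫)
    (hβ₂' : β₂' = ∫ s in (0 : ℝ)..‖W - N‖,
      (‖W - N‖ - s) ^ 2 * ⟪φ (N + s • ((‖W - N‖)⁻¹ • (W - N))), nNW⟫)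
    (hγ : γ = ∫ s in (0 : ℝ)..‖S - W‖, ⟪φ (W + s • ((‖S - W‖)⁻¹ • (S - W))), nWS⟫)
    (hγ₂ : γ₂ = ∫ s in (0 : ℝ)..‖S - W‖,
      s ^ 2 * ⟪φ (W + s • ((‖S - W‖)⁻¹ • (S - W))), nWS⟫)
    (hrelγ : γ₂ = (ρQ ^ 2 + ‖Q - W‖ ^ 2) * γ)
    (hrelβ : β₂' = (ρP ^ 2 + ‖P - W‖ ^ 2) * β)
    (hrelη₂' : η₂' = (ρK ^ 2 + ‖G_K - N‖ ^ 2) * η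
      - (1 / 6) * ⟪B - S, (B - N) + (W - N) + (S - N)⟫ * β
      - (1 / 6) * ⟪C - N, (W - N) + (C - N) + (S - N)⟫ * γ)
    (hrelη₁ : η₁ = (1 / ‖N - S‖) *
      ⟪η • (G_K - S) - β • (P - G_K) - γ • (Q - G_K), N - S⟫) :
    (1 / (2 * (volume (convexHull ℝ ({S, N, W} : Set (EuclideanSpace ℝ (Fin 2))))).toReal)) *
        ∫ x in convexHull ℝ ({S, N, W} : Set (EuclideanSpace ℝ (Fin 2))), ⟪φ x, W - x⟫ =
      (1 / ‖N - S‖) * ⟪η • (G_K - N) - β • (P - G_K) - γ • (Q - G_K), nSN⟫ := by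
  have hinj := hindep.injective
  have hSN : N - S ≠ 0 := fun h => by
    have : (1 : Fin 3) = 0 := hinj (sub_eq_zero.1 h)
    simp at this
  have hNW : W - N ≠ 0 := fun h => by
    have : (2 : Fin 3) = 1 := hinj (sub_eq_zero.1 h)
    simp at this
  have hWS : S - W ≠ 0 := fun h => by
    have : (0 : Fin 3) = 2 := hinj (sub_eq_zero.1 h)
    simp at this
  have hcross := inner_quarterTurn_ne_zero hSN hnSN hnSN0 hnSNW
  obtain ⟨ε, hε, hεneg⟩ := exists_sign_mul_neg hcross
  have hε0 : ε ≠ 0 := by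
    rintro rfl
    norm_num at hε
  have hcyc1 : ⟪S - N, quarterTurn (W - N)⟫ = ⟪W - S, quarterTurn (N - S)⟫ := by
    simp only [inner_quarterTurn, PiLp.sub_apply]
    ring
  have hcyc2 : ⟪N - W, quarterTurn (S - W)⟫ = ⟪W - S, quarterTurn (N - S)⟫ := by
    simp only [inner_quarterTurn, PiLp.sub_apply]
    ring
  have hΔ : ⟪S - W, quarterTurn (N - W)⟫ = -⟪W - S, quarterTurn (N - S)⟫ := by
    simp only [inner_quarterTurn, PiLp.sub_apply]
    ring
  have hrSN := norm_smul_unit_normal hε hnSN hnSN0 hnSNW hεneg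
  have hrNW := norm_smul_unit_normal hε hnNW hnNW0 hnNWS (hcyc1 ▸ hεneg)
  have hrWS := norm_smul_unit_normal hε hnWS hnWS0 hnWSN (hcyc2 ▸ hεneg)
  have hΔ0 : ⟪S - W, quarterTurn (N - W)⟫ ≠ 0 := by
    rw [hΔ]
    exact neg_ne_zero.2 hcross
  have hφc : ContinuousOn φ (convexHull ℝ {S, N, W}) := hφ.continuousOn.mono hKU
  have hφ' : ContinuousOn (fderiv ℝ φ) (convexHull ℝ {S, N, W}) :=
    (hφ.continuousOn_fderiv_of_isOpen hU le_rfl).mono hKU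
  have hφd : ∀ x ∈ convexHull ℝ {S, N, W}, HasFDerivAt φ (fderiv ℝ φ x) x := fun x hx =>
    ((hφ.differentiableOn one_ne_zero).differentiableAt (hU.mem_nhds (hKU hx))).hasFDerivAt
  have hmem : ∀ p ∈ refTriangle, triangleMap S N W p ∈ convexHull ℝ {S, N, W} := fun p hp =>
    triangleMap_image S N W ▸ Set.mem_image_of_mem _ hp
  have hTm := isClosed_refTriangle.measurableSet
  have hdiv1 := integral_trace_triangleMap hφd hφ'
  have hdiv2 := integral_trace_triangleMap (fun x hx => hasFDerivAt_norm_sq_smul W (hφd x hx))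
    (by
      have hl : ContinuousOn (fun x => (2 : ℝ) • innerSL ℝ (x - W))
          (convexHull ℝ {S, N, W}) := by fun_prop
      have hr : ContinuousOn (fun x => ((2 : ℝ) • innerSL ℝ (x - W)).smulRight (φ x))
          (convexHull ℝ {S, N, W}) :=
        ((ContinuousLinearMap.smulRightL ℝ _ _).continuous.comp_continuousOn hl).clm_apply hφc
      exact ((by fun_prop : ContinuousOn (fun x => ‖x - W‖ ^ 2) _).smul hφ').add hr)
  have hT1 : ∫ p in refTriangle, LinearMap.trace ℝ _
      (fderiv ℝ φ (triangleMap S N W p)).toLinearMap = c * (1 / 2) := by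
    rw [← setIntegral_refTriangle_one, ← integral_const_mul]
    refine setIntegral_congr_fun hTm fun p hp => ?_
    simp only [hdiv _ (hmem p hp), mul_one]
  have hF := continuous_triangleMap S N W
  have hint1 : IntegrableOn (fun p => ‖triangleMap S N W p - W‖ ^ 2) refTriangle :=
    ContinuousOn.integrableOn_compact isCompact_refTriangle (by fun_prop)
  have hint2 : IntegrableOn (fun p => ⟪φ (triangleMap S N W p), W - triangleMap S N W p⟫)
      refTriangle :=
    ((hφc.comp hF.continuousOn hmem).inner
      (continuousOn_const.sub hF.continuousOn)).integrableOn_compact isCompact_refTriangle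
  set M := ∫ p in refTriangle, ⟪φ (triangleMap S N W p), W - triangleMap S N W p⟫ with hM
  have hT2 : ∫ p in refTriangle, LinearMap.trace ℝ _
      (‖triangleMap S N W p - W‖ ^ 2 • fderiv ℝ φ (triangleMap S N W p) +
        ((2 : ℝ) • innerSL ℝ (triangleMap S N W p - W)).smulRight
          (φ (triangleMap S N W p))).toLinearMap =
      c * ((‖S - W‖ ^ 2 + ⟪S - W, N - W⟫ + ‖N - W‖ ^ 2) / 12) - 2 * M := by
    rw [← setIntegral_norm_sq_triangleMap, hM, ← integral_const_mul, ← integral_const_mul,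
      ← integral_sub (hint1.const_mul _) (hint2.const_mul _)]
    refine setIntegral_congr_fun hTm fun p hp => ?_
    simp only [trace_norm_sq_smul_add, hdiv _ (hmem p hp)]
    rw [← neg_sub W, inner_neg_left, real_inner_comm]
    ring
  rw [hT1] at hdiv1
  rw [hT2] at hdiv2
  have hseg : ∀ w : ℝ → ℝ, Continuous w → IntervalIntegrable
      (fun t => w t * ⟪φ (S + t • (N - S)), quarterTurn (N - S)⟫) volume 0 1 := by
    intro w hw
    refine ContinuousOn.intervalIntegrable ?_
    rw [Set.uIcc_of_le zero_le_one]
    refine hw.continuousOn.mul ((hφc.comp (by fun_prop) fun t ht => ?_).inner continuousOn_const)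
    exact (convex_convexHull ℝ _).add_smul_sub_mem (subset_convexHull _ _ (by simp))
      (subset_convexHull _ _ (by simp)) ht
  have hη0 := integral_arclength_eq hSN hrSN (fun _ => 1) φ S
  have hη1 := integral_arclength_eq hSN hrSN (fun s => s) φ S
  have hη2 := integral_arclength_eq hSN hrSN (fun s => (‖N - S‖ - s) ^ 2) φ S
  have hβ0 := integral_arclength_eq hNW hrNW (fun _ => 1) φ N
  have hβ2 := integral_arclength_eq hNW hrNW (fun s => (‖W - N‖ - s) ^ 2) φ N
  have hγ0 := integral_arclength_eq hWS hrWS (fun _ => 1) φ W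
  have hγ2 := integral_arclength_eq hWS hrWS (fun s => s ^ 2) φ W
  simp only [one_mul] at hη0 hβ0 hγ0
  rw [hη0] at hη
  rw [hη1] at hη₁
  rw [hη2] at hη₂'
  rw [hβ0] at hβ
  rw [hβ2] at hβ₂'
  rw [hγ0] at hγ
  rw [hγ2] at hγ₂
  set a0 := ∫ t in (0 : ℝ)..1, ⟪φ (S + t • (N - S)), quarterTurn (N - S)⟫ with ha0
  set b0 := ∫ t in (0 : ℝ)..1, ⟪φ (N + t • (W - N)), quarterTurn (W - N)⟫
  set c0 := ∫ t in (0 : ℝ)..1, ⟪φ (W + t • (S - W)), quarterTurn (S - W)⟫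
  obtain ⟨a1, ha1⟩ : ∃ a, a = ∫ t in (0 : ℝ)..1,
      t * ⟪φ (S + t • (N - S)), quarterTurn (N - S)⟫ := ⟨_, rfl⟩
  obtain ⟨a2, ha2⟩ : ∃ a, a = ∫ t in (0 : ℝ)..1,
      t ^ 2 * ⟪φ (S + t • (N - S)), quarterTurn (N - S)⟫ := ⟨_, rfl⟩
  have hi0 : IntervalIntegrable
      (fun t => ⟪φ (S + t • (N - S)), quarterTurn (N - S)⟫) volume 0 1 := by
    simpa using hseg (fun _ => 1) continuous_const
  have hquad : ∀ x y z : ℝ, ∫ t in (0 : ℝ)..1,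
      (x + y * t + z * t ^ 2) * ⟪φ (S + t • (N - S)), quarterTurn (N - S)⟫ =
      x * a0 + y * a1 + z * a2 := by
    intro x y z
    have hi1 := hseg (fun t => t) continuous_id
    have hi2 := hseg (fun t => t ^ 2) (by fun_prop)
    rw [ha0, ha1, ha2, ← intervalIntegral.integral_const_mul,
      ← intervalIntegral.integral_const_mul, ← intervalIntegral.integral_const_mul,
      ← intervalIntegral.integral_add (hi0.const_mul x) (hi1.const_mul y),
      ← intervalIntegral.integral_add ((hi0.const_mul x).add (hi1.const_mul y))
        (hi2.const_mul z)]
    refine intervalIntegral.integral_congr fun t _ => ?_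
    ring
  have hη₁a : η₁ = ε * (‖N - S‖ * a1) := by
    rw [hη₁]
    congr 1
    rw [ha1, ← intervalIntegral.integral_const_mul]
    refine intervalIntegral.integral_congr fun t _ => ?_
    ring
  have hη₂a : η₂' = ε * (‖N - S‖ ^ 2 * (a0 - 2 * a1 + a2)) := by
    rw [hη₂']
    congr 1
    refine Eq.trans (intervalIntegral.integral_congr fun t _ => ?_)
      ((hquad (‖N - S‖ ^ 2) (-2 * ‖N - S‖ ^ 2) (‖N - S‖ ^ 2)).trans (by ring))
    ring
  have hqSN : ∫ t in (0 : ℝ)..1, ⟪‖S + t • (N - S) - W‖ ^ 2 • φ (S + t • (N - S)),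
      quarterTurn (N - S)⟫ =
      ‖S - W‖ ^ 2 * a0 + 2 * ⟪S - W, N - S⟫ * a1 + ‖N - S‖ ^ 2 * a2 := by
    rw [← hquad]
    refine intervalIntegral.integral_congr fun t _ => ?_
    simp only [real_inner_smul_left]
    congr 1
    simp only [norm_sq_eq_coord, inner_eq_coord, PiLp.add_apply, PiLp.sub_apply,
      PiLp.smul_apply, smul_eq_mul]
    ring
  have hqNW : β₂' = ε * ∫ t in (0 : ℝ)..1, ⟪‖N + t • (W - N) - W‖ ^ 2 • φ (N + t • (W - N)),
      quarterTurn (W - N)⟫ := by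
    rw [hβ₂']
    congr 1
    refine intervalIntegral.integral_congr fun t _ => ?_
    simp only [real_inner_smul_left]
    congr 1
    rw [show ‖W - N‖ - ‖W - N‖ * t = ‖W - N‖ * (1 - t) by ring, mul_pow]
    simp only [norm_sq_eq_coord, PiLp.add_apply, PiLp.sub_apply, PiLp.smul_apply, smul_eq_mul]
    ring
  have hqWS : γ₂ = ε * ∫ t in (0 : ℝ)..1, ⟪‖W + t • (S - W) - W‖ ^ 2 • φ (W + t • (S - W)),
      quarterTurn (S - W)⟫ := by
    rw [hγ₂]
    congr 1
    refine intervalIntegral.integral_congr fun t _ => ?_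
    simp only [real_inner_smul_left]
    congr 1
    rw [mul_pow]
    simp only [norm_sq_eq_coord, PiLp.add_apply, PiLp.sub_apply, PiLp.smul_apply, smul_eq_mul]
    ring
  rw [hqSN] at hdiv2
  generalize (∫ t in (0 : ℝ)..1, ⟪‖N + t • (W - N) - W‖ ^ 2 • φ (N + t • (W - N)),
      quarterTurn (W - N)⟫) = b2 at hqNW hdiv2
  generalize (∫ t in (0 : ℝ)..1, ⟪‖W + t • (S - W) - W‖ ^ 2 • φ (W + t • (S - W)),
      quarterTurn (S - W)⟫) = c2 at hqWS hdiv2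
  have hL : ‖N - S‖ ≠ 0 := norm_ne_zero_iff.2 hSN
  have hρK2 : ρK ^ 2 = (1 / 36) * (‖S - N‖ ^ 2 + ‖N - W‖ ^ 2 + ‖W - S‖ ^ 2) := by
    rw [hρK, Real.sq_sqrt (by positivity)]
  have hρP2 : ρP ^ 2 = (1 / 36) * (‖W - N‖ ^ 2 + ‖N - B‖ ^ 2 + ‖B - W‖ ^ 2) := by
    rw [hρP, Real.sq_sqrt (by positivity)]
  have hρQ2 : ρQ ^ 2 = (1 / 36) * (‖S - W‖ ^ 2 + ‖W - C‖ ^ 2 + ‖C - S‖ ^ 2) := by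
    rw [hρQ, Real.sq_sqrt (by positivity)]
  obtain ⟨D, hD, hDK⟩ := exists_setIntegral_triangle_eq hΔ0
  have hvol : (volume (convexHull ℝ ({S, N, W} : Set (EuclideanSpace ℝ (Fin 2))))).toReal =
      D * (1 / 2) := by
    rw [← setIntegral_refTriangle_one, ← hDK fun _ => 1]
    simp [Measure.real]
  have hfactor : (1 / (2 * (D * (1 / 2)))) * (D * M) = M := by
    field_simp
  rw [hvol, hDK, ← hM, hfactor]
  have hB : b2 = (ρP ^ 2 + ‖P - W‖ ^ 2) * b0 := by
    linear_combination (-b2 + (ρP ^ 2 + ‖P - W‖ ^ 2) * b0) * hε + ε * hrelβ - ε * hqNW +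
      ε * (ρP ^ 2 + ‖P - W‖ ^ 2) * hβ
  have hC : c2 = (ρQ ^ 2 + ‖Q - W‖ ^ 2) * c0 := by
    linear_combination (-c2 + (ρQ ^ 2 + ‖Q - W‖ ^ 2) * c0) * hε + ε * hrelγ - ε * hqWS +
      ε * (ρQ ^ 2 + ‖Q - W‖ ^ 2) * hγ
  have hA2 : ‖N - S‖ ^ 2 * (a0 - 2 * a1 + a2) = (ρK ^ 2 + ‖G_K - N‖ ^ 2) * a0
      - (1 / 6) * ⟪B - S, (B - N) + (W - N) + (S - N)⟫ * b0
      - (1 / 6) * ⟪C - N, (W - N) + (C - N) + (S - N)⟫ * c0 := by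
    rw [hη₂a, hη, hβ, hγ] at hrelη₂'
    apply mul_left_cancel₀ hε0
    linear_combination hrelη₂'
  have hA1 : ‖N - S‖ ^ 2 * a1 =
      ⟪a0 • (G_K - S) - b0 • (P - G_K) - c0 • (Q - G_K), N - S⟫ := by
    apply mul_left_cancel₀ hε0
    have h : ‖N - S‖ * η₁ = ⟪η • (G_K - S) - β • (P - G_K) - γ • (Q - G_K), N - S⟫ := by
      rw [hrelη₁]
      field_simp
    rw [hη₁a, hη, hβ, hγ] at h
    simp only [inner_sub_left, real_inner_smul_left] at h ⊢
    linear_combination h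
  have hgoal : ‖N - S‖ ^ 2 * M =
      ⟪a0 • (G_K - N) - b0 • (P - G_K) - c0 • (Q - G_K), quarterTurn (N - S)⟫ := by
    apply mul_left_cancel₀ (mul_ne_zero two_ne_zero hΔ0)
    rw [hρP2] at hB
    rw [hρQ2] at hC
    rw [hρK2] at hA2
    subst hGK hP hQ
    generalize M = m at *
    simp only [inner_quarterTurn] at hdiv1 hdiv2 ⊢
    simp only [norm_sq_eq_coord, inner_eq_coord, PiLp.add_apply, PiLp.sub_apply,
      PiLp.smul_apply, smul_eq_mul] at hdiv1 hdiv2 hA1 hA2 hB hC ⊢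
    linear_combination
      (2 * (((S 0 - W 0) ^ 2 + (S 1 - W 1) ^ 2 +
        ((S 0 - W 0) * (N 0 - W 0) + (S 1 - W 1) * (N 1 - W 1)) +
        ((N 0 - W 0) ^ 2 + (N 1 - W 1) ^ 2)) / 12) * ((N 0 - S 0) ^ 2 + (N 1 - S 1) ^ 2)) * hdiv1 -
      ((N 0 - S 0) ^ 2 + (N 1 - S 1) ^ 2) * (hdiv2 + hB + hC + hA2) -
      2 * ((S 0 - W 0) * (N 0 - S 0) + (S 1 - W 1) * (N 1 - S 1) +
        ((N 0 - S 0) ^ 2 + (N 1 - S 1) ^ 2)) * hA1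
  have hfin : ‖N - S‖ ^ 2 * ⟪η • (G_K - N) - β • (P - G_K) - γ • (Q - G_K), nSN⟫ =
      ‖N - S‖ * (‖N - S‖ ^ 2 * M) := by
    rw [hgoal, hη, hβ, hγ]
    have h : ‖N - S‖ * ⟪(ε * a0) • (G_K - N) - (ε * b0) • (P - G_K) - (ε * c0) • (Q - G_K), nSN⟫ =
        ⟪a0 • (G_K - N) - b0 • (P - G_K) - c0 • (Q - G_K), quarterTurn (N - S)⟫ := by
      rw [← real_inner_smul_right, hrSN]
      simp only [inner_sub_left, real_inner_smul_left, real_inner_smul_right]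
      linear_combination (a0 * ⟪G_K, quarterTurn (N - S)⟫ - a0 * ⟪N, quarterTurn (N - S)⟫ -
        b0 * (⟪P, quarterTurn (N - S)⟫ - ⟪G_K, quarterTurn (N - S)⟫) -
        c0 * (⟪Q, quarterTurn (N - S)⟫ - ⟪G_K, quarterTurn (N - S)⟫)) * hε
    rw [← h]
    ring
  have hX : ⟪η • (G_K - N) - β • (P - G_K) - γ • (Q - G_K), nSN⟫ = ‖N - S‖ * M := by
    apply mul_left_cancel₀ (pow_ne_zero 2 hL)
    linear_combination hfin
  rw [hX]
  field_simp
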